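/- Let A be the Artin group of type D_4 and let (x_0,…,x_5) be a type II 6-cycle. If there exists a left coset z of A_b̂ such that z ∩ x_0, z ∩ x_5, z ∩ x_4 and z ∩ x_3 are all nonempty, then the cycle satisfies property (*): there exists a left coset z' of A_â or of A_b̂ with z' ∩ x_1 ≠ ∅, z' ∩ x_3 ≠ ∅ and z' ∩ x_5 ≠ ∅. -/

import Mathlib

/-!
The Artin group of type `D₄`, with generators `a, b, c, d`, where `d` is the central node of
the Dynkin diagram: relations `ada = dad`, `bdb = dbd`, `cdc = dcd`, `ab = ba`, `ac = ca`,
`bc = cb`.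
-/

open Pointwise

namespace D4Artin

/-- The generators of the `D₄` Artin group. -/
inductive Gen : Type
  | a | b | c | d
deriving DecidableEq

open Gen

/-- The defining relators of the `D₄` Artin group: a braid relation `sts = tst` whenever one of
`s, t` is the central node `d`, and commutation `st = ts` otherwise. -/
def Rels : Set (FreeGroup Gen) :=
  { r | ∃ s t : Gen, s ≠ t ∧
      (((s = d ∨ t = d) ∧
          r = FreeGroup.of s * FreeGroup.of t * FreeGroup.of s *
              (FreeGroup.of t * FreeGroup.of s * FreeGroup.of t)⁻¹) ∨
        ((s ≠ d ∧ t ≠ d) ∧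
          r = FreeGroup.of s * FreeGroup.of t * (FreeGroup.of s)⁻¹ * (FreeGroup.of t)⁻¹)) }

/-- The Artin group of type `D₄`. -/
abbrev Artin : Type := PresentedGroup Rels

/-- The generators, as elements of the Artin group. -/
def gen (s : Gen) : Artin := PresentedGroup.of s

/-- The standard parabolic subgroup `A_ŝ` generated by the three generators other than `s`. -/
def Ahat (s : Gen) : Subgroup Artin :=
  Subgroup.closure { x | ∃ t : Gen, t ≠ s ∧ x = gen t }

/-- `X` is a left coset of the subgroup `H`. -/
def IsCosetOf (X : Set Artin) (H : Subgroup Artin) : Prop :=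
  ∃ g : Artin, X = g • (H : Set Artin)

/-- A type II 6-cycle: `x 0, x 4` are distinct left cosets of `A_â`, `x 2` is a left coset of
`A_b̂`, `x 1, x 3, x 5` are pairwise distinct left cosets of `A_ĉ`, and consecutive cosets
(indices mod 6) have nonempty intersection. -/
def TypeII (x : Fin 6 → Set Artin) : Prop :=
  IsCosetOf (x 0) (Ahat a) ∧ IsCosetOf (x 4) (Ahat a) ∧ IsCosetOf (x 2) (Ahat b) ∧
  IsCosetOf (x 1) (Ahat c) ∧ IsCosetOf (x 3) (Ahat c) ∧ IsCosetOf (x 5) (Ahat c) ∧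
  x 0 ≠ x 4 ∧ x 1 ≠ x 3 ∧ x 1 ≠ x 5 ∧ x 3 ≠ x 5 ∧
  ∀ i : Fin 6, (x i ∩ x (i + 1)).Nonempty

/-- Property `(*)` for a 6-cycle: there is a left coset of `A_â` or of `A_b̂` meeting each of
`x 1`, `x 3`, `x 5`. -/
def Star (x : Fin 6 → Set Artin) : Prop :=
  ∃ z : Set Artin, (IsCosetOf z (Ahat a) ∨ IsCosetOf z (Ahat b)) ∧
    (z ∩ x 1).Nonempty ∧ (z ∩ x 3).Nonempty ∧ (z ∩ x 5).Nonempty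

end D4Artin

namespace D4Artin

open Gen

section Lift

variable {G : Type*} [Group G]

/-- The homomorphism out of the `D₄` Artin group determined by images of the generators. -/
def lift (f : Gen → G) (hd : ∀ s, s ≠ d → f s * f d * f s = f d * f s * f d)
    (hc : ∀ s t, s ≠ d → t ≠ d → f s * f t = f t * f s) : Artin →* G :=
  PresentedGroup.toGroup (f := f) <| by
    rintro r ⟨s, t, hst, ⟨hsd, rfl⟩ | ⟨⟨hs, ht⟩, rfl⟩⟩
    · simp only [map_mul, map_inv, FreeGroup.lift_apply_of, mul_inv_eq_one]
      rcases hsd with rfl | rfl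
      · exact (hd t hst.symm).symm
      · exact hd s hst
    · simp only [map_mul, map_inv, FreeGroup.lift_apply_of, mul_inv_eq_iff_eq_mul, one_mul]
      exact hc s t hs ht

@[simp]
theorem lift_gen (f : Gen → G) (hd : ∀ s, s ≠ d → f s * f d * f s = f d * f s * f d)
    (hc : ∀ s t, s ≠ d → t ≠ d → f s * f t = f t * f s) (s : Gen) :
    lift f hd hc (gen s) = f s :=
  PresentedGroup.toGroup.of _

theorem hom_ext {φ ψ : Artin →* G} (h : ∀ s, φ (gen s) = ψ (gen s)) : φ = ψ :=
  PresentedGroup.ext h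

theorem gen_braid {s : Gen} (hs : s ≠ d) : gen s * gen d * gen s = gen d * gen s * gen d :=
  PresentedGroup.mk_eq_mk_of_mul_inv_mem ⟨s, d, hs, .inl ⟨.inr rfl, rfl⟩⟩

theorem gen_comm {s t : Gen} (hs : s ≠ d) (ht : t ≠ d) : gen s * gen t = gen t * gen s := by
  rcases eq_or_ne s t with rfl | hst
  · rfl
  · refine PresentedGroup.mk_eq_mk_of_mul_inv_mem
      (x := FreeGroup.of s * FreeGroup.of t) (y := FreeGroup.of t * FreeGroup.of s)
      ⟨s, t, hst, .inr ⟨⟨hs, ht⟩, ?_⟩⟩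
    rw [mul_inv_rev, mul_assoc (_ * _)]

/-- The homomorphism from `ℤˣ` determined by an element squaring to one. -/
def unitsLift (g : G) (hg : g * g = 1) : ℤˣ →* G where
  toFun u := if u = 1 then 1 else g
  map_one' := if_pos rfl
  map_mul' u v := by
    rcases Int.units_eq_one_or u with rfl | rfl <;>
      rcases Int.units_eq_one_or v with rfl | rfl <;> simp [hg]

@[simp]
theorem unitsLift_neg_one (g : G) (hg : g * g = 1) : unitsLift g hg (-1) = g :=
  if_neg (c := (-1 : ℤˣ) = 1) (t := 1) (by decide)

theorem mem_normalizer_closure {S : Set G} {g : G}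
    (h : ∀ s ∈ S, g * s * g⁻¹ ∈ Subgroup.closure S)
    (h' : ∀ s ∈ S, g⁻¹ * s * g ∈ Subgroup.closure S) :
    g ∈ Subgroup.normalizer (Subgroup.closure S : Set G) := by
  have key (x : G) (hx : ∀ s ∈ S, x * s * x⁻¹ ∈ Subgroup.closure S) :
      Subgroup.closure S ≤ (Subgroup.closure S).comap (MulAut.conj x).toMonoidHom :=
    (Subgroup.closure_le _).2 fun s hs => by simpa using hx s hs
  refine Subgroup.mem_normalizer_iff.2 fun u => ⟨fun hu => key g h hu, fun hu => ?_⟩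
  have := key g⁻¹ (by simpa using h') hu
  simpa [mul_assoc] using this

end Lift

/-- The diagram automorphism exchanging `a` and `b`. -/
def swapGen : Gen → Gen
  | a => b
  | b => a
  | c => c
  | d => d

theorem swapGen_ne_d {s : Gen} (hs : s ≠ d) : swapGen s ≠ d := by
  cases s <;> simp_all [swapGen]

/-- The endomorphism of the Artin group exchanging `a` and `b`. -/
def swapHom : Artin →* Artin :=
  lift (fun s => gen (swapGen s)) (fun _ hs => gen_braid (swapGen_ne_d hs))
    (fun _ _ hs ht => gen_comm (swapGen_ne_d hs) (swapGen_ne_d ht))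

@[simp]
theorem swapHom_gen (s : Gen) : swapHom (gen s) = gen (swapGen s) := lift_gen _ _ _ _

theorem swapHom_swapHom (g : Artin) : swapHom (swapHom g) = g := by
  have : swapHom.comp swapHom = MonoidHom.id Artin :=
    hom_ext fun s => by cases s <;> simp [swapGen]
  exact DFunLike.congr_fun this g

/-- The automorphism of the Artin group exchanging `a` and `b`. -/
def swapAut : MulAut Artin :=
  MonoidHom.toMulEquiv swapHom swapHom (MonoidHom.ext swapHom_swapHom)
    (MonoidHom.ext swapHom_swapHom)

@[simp]
theorem swapAut_apply (g : Artin) : swapAut g = swapHom g := rfl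

/-- The action of `ℤˣ` on the Artin group by exchanging `a` and `b`. -/
def swapAction : ℤˣ →* MulAut Artin :=
  unitsLift swapAut (MulEquiv.ext swapHom_swapHom)

@[simp]
theorem swapAction_neg_one : swapAction (-1) = swapAut := unitsLift_neg_one _ _

/-- The extension of the Artin group by the involution exchanging `a` and `b`. -/
abbrev ExtArtin : Type := Artin ⋊[swapAction] ℤˣ

/-- The inclusion of the Artin group in its extension. -/
abbrev incl : Artin →* ExtArtin := SemidirectProduct.inl

/-- The involution of the extension which exchanges `a` and `b` by conjugation. -/
def invol : ExtArtin := SemidirectProduct.inr (-1)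

@[simp]
theorem invol_mul_invol : invol * invol = 1 := by
  rw [invol, ← map_mul]; simp

@[simp]
theorem invol_inv : invol⁻¹ = invol := inv_eq_of_mul_eq_one_left invol_mul_invol

theorem incl_swapHom (g : Artin) : incl (swapHom g) = invol * incl g * invol := by
  have := SemidirectProduct.inl_aut (φ := swapAction) (-1) g
  rw [swapAction_neg_one] at this
  exact this

theorem swapHom_mem_Ahat {s : Gen} {g : Artin} (hg : g ∈ Ahat s) :
    swapHom g ∈ Ahat (swapGen s) := by
  have : Ahat s ≤ (Ahat (swapGen s)).comap swapHom := by
    refine (Subgroup.closure_le _).2 ?_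
    rintro _ ⟨t, ht, rfl⟩
    refine Subgroup.subset_closure ⟨swapGen t, ?_, swapHom_gen t⟩
    revert ht
    cases s <;> cases t <;> simp [swapGen]
  exact this hg

theorem gen_mem_Ahat {s t : Gen} (h : t ≠ s) : gen t ∈ Ahat s :=
  Subgroup.subset_closure ⟨t, h, rfl⟩

section Reflections

/-- The conjugate of `invol` by `a`. -/
def refl₂ : ExtArtin := incl (gen a) * invol * (incl (gen a))⁻¹

/-- The conjugate of `refl₂` by `d`. -/
def refl₃ : ExtArtin := incl (gen d) * refl₂ * (incl (gen d))⁻¹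

/-- The conjugate of `refl₃` by `c`. -/
def refl₄ : ExtArtin := incl (gen c) * refl₃ * (incl (gen c))⁻¹

theorem refl₂_mul_self : refl₂ * refl₂ = 1 := by
  simp [refl₂, mul_assoc, ← mul_assoc invol invol]

theorem refl₃_mul_self : refl₃ * refl₃ = 1 := by
  simp [refl₃, mul_assoc, ← mul_assoc refl₂ refl₂, refl₂_mul_self]

theorem refl₄_mul_self : refl₄ * refl₄ = 1 := by
  simp [refl₄, mul_assoc, ← mul_assoc refl₃ refl₃, refl₃_mul_self]

theorem incl_gen_b : incl (gen b) = invol * incl (gen a) * invol :=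
  incl_swapHom (gen a) ▸ by simp [swapGen]

theorem invol_comm {s : Gen} (hs : swapGen s = s) : SemiconjBy (incl (gen s)) invol invol := by
  have h := incl_swapHom (gen s)
  rw [swapHom_gen, hs] at h
  rw [SemiconjBy]
  nth_rw 1 [h]
  simp [mul_assoc]

theorem conj_a_invol : SemiconjBy (incl (gen a)) invol refl₂ := by
  simp [SemiconjBy, refl₂]

theorem conj_d_refl₂ : SemiconjBy (incl (gen d)) refl₂ refl₃ := by
  simp [SemiconjBy, refl₃]

theorem conj_c_refl₃ : SemiconjBy (incl (gen c)) refl₃ refl₄ := by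
  simp [SemiconjBy, refl₄]

theorem incl_gen_comm {s t : Gen} (hs : s ≠ d) (ht : t ≠ d) :
    SemiconjBy (incl (gen s)) (incl (gen t)) (incl (gen t)) := by
  rw [SemiconjBy, ← map_mul, gen_comm hs ht, map_mul]

theorem incl_gen_braid {s : Gen} (hs : s ≠ d) :
    SemiconjBy (incl (gen s) * incl (gen d)) (incl (gen s)) (incl (gen d)) := by
  rw [SemiconjBy, ← map_mul, ← map_mul, gen_braid hs, ← map_mul, mul_assoc]

theorem incl_gen_braid' {s : Gen} (hs : s ≠ d) :
    SemiconjBy (incl (gen d) * incl (gen s)) (incl (gen d)) (incl (gen s)) := by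
  rw [SemiconjBy, ← map_mul, ← map_mul, ← gen_braid hs, ← map_mul, mul_assoc]

theorem semiconjBy_transport {G : Type*} [Group G] {x u v w u' v' w' : G} (h : SemiconjBy u v w)
    (hu : SemiconjBy x u u') (hv : SemiconjBy x v v') (hw : SemiconjBy x w w') :
    SemiconjBy u' v' w' := by
  obtain rfl : u' = x * u * x⁻¹ := eq_mul_inv_of_mul_eq hu.symm
  obtain rfl : v' = x * v * x⁻¹ := eq_mul_inv_of_mul_eq hv.symm
  obtain rfl : w' = x * w * x⁻¹ := eq_mul_inv_of_mul_eq hw.symm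
  rw [SemiconjBy] at h ⊢
  simp [mul_assoc, ← mul_assoc u v, h]

theorem conj_a_refl₂ : SemiconjBy (incl (gen a)) refl₂ (refl₂ * invol * refl₂) := by
  have h : incl (gen a) * (invol * incl (gen a) * invol)
      = invol * incl (gen a) * invol * incl (gen a) := by
    rw [← incl_gen_b]; exact incl_gen_comm (by decide) (by decide)
  have h₂ : refl₂ = invol * (incl (gen a))⁻¹ * invol * incl (gen a) * invol := by
    rw [refl₂, mul_inv_eq_iff_eq_mul]
    simp only [mul_assoc] at h ⊢
    rw [← h]
    simp [← mul_assoc invol invol]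
  calc incl (gen a) * refl₂
      = incl (gen a) * invol * (incl (gen a))⁻¹ * invol * incl (gen a) * invol := by
        rw [h₂]; simp [mul_assoc]
    _ = refl₂ * invol * refl₂ * incl (gen a) := by simp [refl₂, mul_assoc]

theorem conj_d_invol : SemiconjBy (incl (gen d)) invol invol := invol_comm rfl

theorem conj_c_invol : SemiconjBy (incl (gen c)) invol invol := invol_comm rfl

theorem conj_c_refl₂ : SemiconjBy (incl (gen c)) refl₂ refl₂ :=
  have h : SemiconjBy (incl (gen c)) (incl (gen a)) (incl (gen a)) :=
    incl_gen_comm (by decide) (by decide)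
  (h.mul_right conj_c_invol).mul_right h.inv_right

theorem conj_a_refl₃ : SemiconjBy (incl (gen a)) refl₃ refl₃ :=
  have h := conj_d_refl₂.mul_left conj_a_invol
  semiconjBy_transport conj_d_invol (incl_gen_braid' (by decide)) h h

theorem conj_d_refl₃ : SemiconjBy (incl (gen d)) refl₃ (refl₃ * refl₂ * refl₃) :=
  have h₁ := conj_a_invol.mul_left conj_d_invol
  have h₂ := conj_a_refl₃.mul_left conj_d_refl₂
  semiconjBy_transport conj_a_refl₂ (incl_gen_braid (by decide)) h₂
    ((h₂.mul_right h₁).mul_right h₂)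

theorem conj_a_refl₄ : SemiconjBy (incl (gen a)) refl₄ refl₄ :=
  semiconjBy_transport conj_a_refl₃ (incl_gen_comm (by decide) (by decide)) conj_c_refl₃
    conj_c_refl₃

theorem conj_d_refl₄ : SemiconjBy (incl (gen d)) refl₄ refl₄ :=
  have h := conj_c_refl₃.mul_left conj_d_refl₂
  semiconjBy_transport conj_c_refl₂ (incl_gen_braid (by decide)) h h

theorem conj_c_refl₄ : SemiconjBy (incl (gen c)) refl₄ (refl₄ * refl₃ * refl₄) :=
  have h₁ := conj_d_refl₂.mul_left conj_c_refl₂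
  have h₂ := conj_d_refl₄.mul_left conj_c_refl₃
  semiconjBy_transport conj_d_refl₃ (incl_gen_braid' (by decide)) h₂
    ((h₂.mul_right h₁).mul_right h₂)

end Reflections

/-- The subgroup generated by the first three reflections. -/
def reflSubgroup₃ : Subgroup ExtArtin := Subgroup.closure {invol, refl₂, refl₃}

/-- The subgroup generated by the four reflections. -/
def reflSubgroup₄ : Subgroup ExtArtin := Subgroup.closure {invol, refl₂, refl₃, refl₄}

theorem invol_mem₃ : invol ∈ reflSubgroup₃ := Subgroup.subset_closure (by simp)

theorem refl₂_mem₃ : refl₂ ∈ reflSubgroup₃ := Subgroup.subset_closure (by simp)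

theorem refl₃_mem₃ : refl₃ ∈ reflSubgroup₃ := Subgroup.subset_closure (by simp)

theorem reflSubgroup₃_le : reflSubgroup₃ ≤ reflSubgroup₄ :=
  Subgroup.closure_mono (by intro; simp; tauto)

theorem refl₄_mem₄ : refl₄ ∈ reflSubgroup₄ := Subgroup.subset_closure (by simp)

theorem semiconjBy_inv_of_braid {G : Type*} [Group G] {x u v : G}
    (hv : v * v = 1) (h₁ : SemiconjBy x u v) (h₂ : SemiconjBy x v (v * u * v)) :
    SemiconjBy x⁻¹ u (u * v * u) := by
  refine SemiconjBy.inv_symm_left ?_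
  have := (h₁.mul_right h₂).mul_right h₁
  rwa [mul_assoc v u v, ← mul_assoc v v, hv, one_mul, mul_assoc u v v, hv, mul_one] at this

theorem mul_mul_inv_mem_of_semiconjBy {G : Type*} [Group G] {K : Subgroup G} {x u v : G}
    (h : SemiconjBy x u v) (hv : v ∈ K) : x * u * x⁻¹ ∈ K := by
  rwa [mul_inv_eq_of_eq_mul h]

theorem inv_mul_mul_mem_of_semiconjBy {G : Type*} [Group G] {K : Subgroup G} {x u v : G}
    (h : SemiconjBy x⁻¹ u v) (hv : v ∈ K) : x⁻¹ * u * x ∈ K := by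
  simpa using mul_mul_inv_mem_of_semiconjBy h hv

theorem incl_a_mem_normalizer₃ :
    incl (gen a) ∈ Subgroup.normalizer (reflSubgroup₃ : Set ExtArtin) := by
  refine mem_normalizer_closure ?_ ?_
  · rintro s (rfl | rfl | rfl)
    · exact mul_mul_inv_mem_of_semiconjBy conj_a_invol refl₂_mem₃
    · exact mul_mul_inv_mem_of_semiconjBy conj_a_refl₂
        (mul_mem (mul_mem refl₂_mem₃ invol_mem₃) refl₂_mem₃)
    · exact mul_mul_inv_mem_of_semiconjBy conj_a_refl₃ refl₃_mem₃
  · rintro s (rfl | rfl | rfl)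
    · exact inv_mul_mul_mem_of_semiconjBy
        (semiconjBy_inv_of_braid refl₂_mul_self conj_a_invol conj_a_refl₂)
        (mul_mem (mul_mem invol_mem₃ refl₂_mem₃) invol_mem₃)
    · exact inv_mul_mul_mem_of_semiconjBy conj_a_invol.inv_symm_left invol_mem₃
    · exact inv_mul_mul_mem_of_semiconjBy conj_a_refl₃.inv_symm_left refl₃_mem₃

theorem incl_d_mem_normalizer₃ :
    incl (gen d) ∈ Subgroup.normalizer (reflSubgroup₃ : Set ExtArtin) := by
  refine mem_normalizer_closure ?_ ?_
  · rintro s (rfl | rfl | rfl)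
    · exact mul_mul_inv_mem_of_semiconjBy conj_d_invol invol_mem₃
    · exact mul_mul_inv_mem_of_semiconjBy conj_d_refl₂ refl₃_mem₃
    · exact mul_mul_inv_mem_of_semiconjBy conj_d_refl₃
        (mul_mem (mul_mem refl₃_mem₃ refl₂_mem₃) refl₃_mem₃)
  · rintro s (rfl | rfl | rfl)
    · exact inv_mul_mul_mem_of_semiconjBy conj_d_invol.inv_symm_left invol_mem₃
    · exact inv_mul_mul_mem_of_semiconjBy
        (semiconjBy_inv_of_braid refl₃_mul_self conj_d_refl₂ conj_d_refl₃)
        (mul_mem (mul_mem refl₂_mem₃ refl₃_mem₃) refl₂_mem₃)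
    · exact inv_mul_mul_mem_of_semiconjBy conj_d_refl₂.inv_symm_left refl₂_mem₃

theorem incl_mem_normalizer₄_of_semiconjBy {g : Artin}
    (h : incl g ∈ Subgroup.normalizer (reflSubgroup₃ : Set ExtArtin))
    (h₄ : SemiconjBy (incl g) refl₄ refl₄) :
    incl g ∈ Subgroup.normalizer (reflSubgroup₄ : Set ExtArtin) := by
  have hconj {u} (hu : u ∈ reflSubgroup₃) : incl g * u * (incl g)⁻¹ ∈ reflSubgroup₄ :=
    reflSubgroup₃_le ((Subgroup.mem_normalizer_iff.1 h u).1 hu)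
  have hconj' {u} (hu : u ∈ reflSubgroup₃) : (incl g)⁻¹ * u * incl g ∈ reflSubgroup₄ :=
    reflSubgroup₃_le ((Subgroup.mem_normalizer_iff''.1 h u).1 hu)
  refine mem_normalizer_closure ?_ ?_
  · rintro s (rfl | rfl | rfl | rfl)
    · exact hconj invol_mem₃
    · exact hconj refl₂_mem₃
    · exact hconj refl₃_mem₃
    · exact mul_mul_inv_mem_of_semiconjBy h₄ refl₄_mem₄
  · rintro s (rfl | rfl | rfl | rfl)
    · exact hconj' invol_mem₃
    · exact hconj' refl₂_mem₃
    · exact hconj' refl₃_mem₃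
    · exact inv_mul_mul_mem_of_semiconjBy h₄.inv_symm_left refl₄_mem₄

theorem incl_c_mem_normalizer₄ :
    incl (gen c) ∈ Subgroup.normalizer (reflSubgroup₄ : Set ExtArtin) := by
  have h₁ := reflSubgroup₃_le invol_mem₃
  have h₂ := reflSubgroup₃_le refl₂_mem₃
  have h₃ := reflSubgroup₃_le refl₃_mem₃
  refine mem_normalizer_closure ?_ ?_
  · rintro s (rfl | rfl | rfl | rfl)
    · exact mul_mul_inv_mem_of_semiconjBy conj_c_invol h₁
    · exact mul_mul_inv_mem_of_semiconjBy conj_c_refl₂ h₂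
    · exact mul_mul_inv_mem_of_semiconjBy conj_c_refl₃ refl₄_mem₄
    · exact mul_mul_inv_mem_of_semiconjBy conj_c_refl₄
        (mul_mem (mul_mem refl₄_mem₄ h₃) refl₄_mem₄)
  · rintro s (rfl | rfl | rfl | rfl)
    · exact inv_mul_mul_mem_of_semiconjBy conj_c_invol.inv_symm_left h₁
    · exact inv_mul_mul_mem_of_semiconjBy conj_c_refl₂.inv_symm_left h₂
    · exact inv_mul_mul_mem_of_semiconjBy
        (semiconjBy_inv_of_braid refl₄_mul_self conj_c_refl₃ conj_c_refl₄)
        (mul_mem (mul_mem h₃ refl₄_mem₄) h₃)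
    · exact inv_mul_mul_mem_of_semiconjBy conj_c_refl₃.inv_symm_left h₃

theorem incl_mem_normalizer₄ {g : Artin} (hg : g ∈ Ahat b) :
    incl g ∈ Subgroup.normalizer (reflSubgroup₄ : Set ExtArtin) := by
  have : Ahat b ≤ (Subgroup.normalizer (reflSubgroup₄ : Set ExtArtin)).comap incl := by
    refine (Subgroup.closure_le _).2 ?_
    rintro _ ⟨s, hs, rfl⟩
    cases s
    · exact incl_mem_normalizer₄_of_semiconjBy incl_a_mem_normalizer₃ conj_a_refl₄
    · exact absurd rfl hs
    · exact incl_c_mem_normalizer₄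
    · exact incl_mem_normalizer₄_of_semiconjBy incl_d_mem_normalizer₃ conj_d_refl₄
  exact this hg

theorem incl_conj_mem₄ {g : Artin} (hg : g ∈ Ahat b) {u : ExtArtin} (hu : u ∈ reflSubgroup₄) :
    incl g * u * (incl g)⁻¹ ∈ reflSubgroup₄ :=
  (Subgroup.mem_normalizer_iff.1 (incl_mem_normalizer₄ hg) u).1 hu

/-- Every element of `A_ĉ` is a product of an element of `reflSubgroup₃` and one of `A_b̂`. -/
theorem exists_factorization {g : Artin} (hg : g ∈ Ahat c) :
    ∃ h ∈ reflSubgroup₃, ∃ k ∈ Ahat b, incl g = h * incl k := by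
  have hmul {x : Artin} (hx : incl x ∈ Subgroup.normalizer (reflSubgroup₃ : Set ExtArtin))
      (hxb : x ∈ Ahat b) {w : ExtArtin} (hw : ∃ h ∈ reflSubgroup₃, ∃ k ∈ Ahat b, w = h * incl k) :
      ∃ h ∈ reflSubgroup₃, ∃ k ∈ Ahat b, incl x * w = h * incl k := by
    obtain ⟨h, hh, k, hk, rfl⟩ := hw
    exact ⟨_, (Subgroup.mem_normalizer_iff.1 hx h).1 hh, x * k, mul_mem hxb hk, by
      simp [mul_assoc]⟩
  have hmul' {x w : ExtArtin} (hx : x ∈ reflSubgroup₃)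
      (hw : ∃ h ∈ reflSubgroup₃, ∃ k ∈ Ahat b, w = h * incl k) :
      ∃ h ∈ reflSubgroup₃, ∃ k ∈ Ahat b, x * w = h * incl k := by
    obtain ⟨h, hh, k, hk, rfl⟩ := hw
    exact ⟨_, mul_mem hx hh, k, hk, by simp [mul_assoc]⟩
  have ha : gen a ∈ Ahat b := gen_mem_Ahat (by decide)
  have hd : gen d ∈ Ahat b := gen_mem_Ahat (by decide)
  have hb : incl (gen b) = invol * refl₂ * incl (gen a) := by
    rw [incl_gen_b, refl₂]; simp [mul_assoc]
  have hr : invol * refl₂ ∈ reflSubgroup₃ := mul_mem invol_mem₃ refl₂_mem₃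
  induction hg using Subgroup.closure_induction_left with
  | one => exact ⟨1, one_mem _, 1, one_mem _, by simp⟩
  | mul_left x hx y _ ih =>
    obtain ⟨s, hs, rfl⟩ := hx
    rw [map_mul]
    cases s
    · exact hmul incl_a_mem_normalizer₃ ha ih
    · rw [hb, mul_assoc _ (incl (gen a))]
      exact hmul' hr (hmul incl_a_mem_normalizer₃ ha ih)
    · exact absurd rfl hs
    · exact hmul incl_d_mem_normalizer₃ hd ih
  | inv_mul_cancel x hx y _ ih =>
    obtain ⟨s, hs, rfl⟩ := hx
    rw [map_mul]
    cases s
    · exact hmul (by simpa using inv_mem incl_a_mem_normalizer₃) (inv_mem ha) ih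
    · rw [map_inv, hb, mul_inv_rev, mul_assoc, ← map_inv]
      exact hmul (by simpa using inv_mem incl_a_mem_normalizer₃) (inv_mem ha)
        (hmul' (inv_mem hr) ih)
    · exact absurd rfl hs
    · exact hmul (by simpa using inv_mem incl_d_mem_normalizer₃) (inv_mem hd) ih

theorem swapAction_mem_Ahat (u : ℤˣ) {g : Artin} (hg : g ∈ Ahat c) :
    swapAction u g ∈ Ahat c := by
  rcases Int.units_eq_one_or u with rfl | rfl
  · simpa using hg
  · rw [swapAction_neg_one]
    exact swapHom_mem_Ahat (s := c) hg

/-- The elements of the extension whose Artin component lies in `A_ĉ`. -/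
def extAhat : Subgroup ExtArtin where
  carrier := {x | x.left ∈ Ahat c}
  one_mem' := (Ahat c).one_mem
  mul_mem' {x y} hx hy := (Ahat c).mul_mem hx (swapAction_mem_Ahat x.right hy)
  inv_mem' {x} hx := by
    rw [Set.mem_ofPred_eq, SemidirectProduct.inv_left]
    exact swapAction_mem_Ahat _ ((Ahat c).inv_mem hx)

theorem mem_extAhat {x : ExtArtin} : x ∈ extAhat ↔ x.left ∈ Ahat c := Iff.rfl

theorem incl_mem_extAhat {g : Artin} : incl g ∈ extAhat ↔ g ∈ Ahat c := by
  simp [mem_extAhat]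

theorem invol_mem_extAhat : invol ∈ extAhat := (Ahat c).one_mem

theorem reflSubgroup₃_le_extAhat : reflSubgroup₃ ≤ extAhat := by
  have ha : incl (gen a) ∈ extAhat := incl_mem_extAhat.2 (gen_mem_Ahat (by decide))
  have hd : incl (gen d) ∈ extAhat := incl_mem_extAhat.2 (gen_mem_Ahat (by decide))
  have h₂ : refl₂ ∈ extAhat := mul_mem (mul_mem ha invol_mem_extAhat) (inv_mem ha)
  refine (Subgroup.closure_le _).2 ?_
  rintro _ (rfl | rfl | rfl)
  · exact invol_mem_extAhat
  · exact h₂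
  · exact mul_mem (mul_mem hd h₂) (inv_mem hd)

/-- The map identifying `b` with `a`. -/
def foldGen : Gen → Gen
  | a => a
  | b => a
  | c => c
  | d => d

theorem foldGen_ne_d {s : Gen} (hs : s ≠ d) : foldGen s ≠ d := by
  cases s <;> simp_all [foldGen]

/-- The endomorphism of the Artin group sending `b` to `a`. -/
def foldHom : Artin →* Artin :=
  lift (fun s => gen (foldGen s)) (fun _ hs => gen_braid (foldGen_ne_d hs))
    (fun _ _ hs ht => gen_comm (foldGen_ne_d hs) (foldGen_ne_d ht))

@[simp]
theorem foldHom_gen (s : Gen) : foldHom (gen s) = gen (foldGen s) := lift_gen _ _ _ _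

theorem foldHom_swapHom (g : Artin) : foldHom (swapHom g) = foldHom g := by
  have : foldHom.comp swapHom = foldHom :=
    hom_ext fun s => by cases s <;> simp [swapGen, foldGen]
  exact DFunLike.congr_fun this g

/-- The retraction of the extension onto `A_b̂`. -/
def retract : ExtArtin →* Artin :=
  SemidirectProduct.lift foldHom 1 fun u => MonoidHom.ext fun g => by
    rcases Int.units_eq_one_or u with rfl | rfl
    · simp
    · simpa using foldHom_swapHom g

@[simp]
theorem retract_incl (g : Artin) : retract (incl g) = foldHom g :=
  SemidirectProduct.lift_inl _ _ _ _

@[simp]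
theorem retract_invol : retract invol = 1 := SemidirectProduct.lift_inr _ _ _ _

theorem foldHom_of_mem {g : Artin} (hg : g ∈ Ahat b) : foldHom g = g := by
  have : Ahat b ≤ foldHom.eqLocus (MonoidHom.id _) := by
    refine (Subgroup.closure_le _).2 ?_
    rintro _ ⟨s, hs, rfl⟩
    cases s <;> first | exact foldHom_gen _ | exact absurd rfl hs
  exact this hg

theorem retract_of_mem {u : ExtArtin} (hu : u ∈ reflSubgroup₄) : retract u = 1 := by
  have : reflSubgroup₄ ≤ retract.ker := by
    refine (Subgroup.closure_le _).2 ?_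
    rintro _ (rfl | rfl | rfl | rfl) <;> simp [MonoidHom.mem_ker, refl₂, refl₃, refl₄]
  exact this hu

theorem mul_incl_inj {u u' : ExtArtin} (hu : u ∈ reflSubgroup₄) (hu' : u' ∈ reflSubgroup₄)
    {k k' : Artin} (hk : k ∈ Ahat b) (hk' : k' ∈ Ahat b) (h : u * incl k = u' * incl k') :
    u = u' := by
  have h' := congrArg retract h
  rw [map_mul, map_mul, retract_of_mem hu, retract_of_mem hu', retract_incl, retract_incl,
    foldHom_of_mem hk, foldHom_of_mem hk', one_mul, one_mul] at h'
  subst h'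
  exact mul_right_cancel h

/-- A triple `(x, l, v)` of a symmetric form `x` on a free module of rank four with basis indexed
by `1, 2, 3, 4` (only off-diagonal entries are recorded, up to sign), a linear form `l` on it, and
a vector `v`. -/
@[ext]
structure Pt (k : Type*) where
  x₁₂ : k
  x₁₃ : k
  x₁₄ : k
  x₂₃ : k
  x₂₄ : k
  x₃₄ : k
  l₁ : k
  l₂ : k
  l₃ : k
  l₄ : k
  v₁ : k
  v₂ : k
  v₃ : k
  v₄ : k

namespace Pt

variable {k : Type*} [CommRing k]

/-- The affine reflection in the first basis vector. -/
def s₁ : Equiv.Perm (Pt k) where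
  toFun p := { p with v₁ := p.l₁ - p.v₁ + p.x₁₂ * p.v₂ + p.x₁₃ * p.v₃ + p.x₁₄ * p.v₄ }
  invFun p := { p with v₁ := p.l₁ - p.v₁ + p.x₁₂ * p.v₂ + p.x₁₃ * p.v₃ + p.x₁₄ * p.v₄ }
  left_inv p := by ext <;> simp; ring
  right_inv p := by ext <;> simp; ring

/-- The affine reflection in the second basis vector. -/
def s₂ : Equiv.Perm (Pt k) where
  toFun p := { p with v₂ := p.l₂ - p.v₂ + p.x₁₂ * p.v₁ + p.x₂₃ * p.v₃ + p.x₂₄ * p.v₄ }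
  invFun p := { p with v₂ := p.l₂ - p.v₂ + p.x₁₂ * p.v₁ + p.x₂₃ * p.v₃ + p.x₂₄ * p.v₄ }
  left_inv p := by ext <;> simp; ring
  right_inv p := by ext <;> simp; ring

/-- The affine reflection in the third basis vector. -/
def s₃ : Equiv.Perm (Pt k) where
  toFun p := { p with v₃ := p.l₃ - p.v₃ + p.x₁₃ * p.v₁ + p.x₂₃ * p.v₂ + p.x₃₄ * p.v₄ }
  invFun p := { p with v₃ := p.l₃ - p.v₃ + p.x₁₃ * p.v₁ + p.x₂₃ * p.v₂ + p.x₃₄ * p.v₄ }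
  left_inv p := by ext <;> simp; ring
  right_inv p := by ext <;> simp; ring

/-- The affine reflection in the fourth basis vector. -/
def s₄ : Equiv.Perm (Pt k) where
  toFun p := { p with v₄ := p.l₄ - p.v₄ + p.x₁₄ * p.v₁ + p.x₂₄ * p.v₂ + p.x₃₄ * p.v₃ }
  invFun p := { p with v₄ := p.l₄ - p.v₄ + p.x₁₄ * p.v₁ + p.x₂₄ * p.v₂ + p.x₃₄ * p.v₃ }
  left_inv p := by ext <;> simp; ring
  right_inv p := by ext <;> simp; ring

/-- The braid move on the first two basis vectors. -/
def T₁ : Equiv.Perm (Pt k) where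
  toFun p :=
    ⟨-p.x₁₂, p.x₂₃ + p.x₁₂ * p.x₁₃, p.x₂₄ + p.x₁₂ * p.x₁₄, p.x₁₃, p.x₁₄, p.x₃₄,
      p.l₂ + p.x₁₂ * p.l₁, p.l₁, p.l₃, p.l₄, p.v₂, p.v₁ - p.x₁₂ * p.v₂, p.v₃, p.v₄⟩
  invFun p :=
    ⟨-p.x₁₂, p.x₂₃, p.x₂₄, p.x₁₃ + p.x₁₂ * p.x₂₃, p.x₁₄ + p.x₁₂ * p.x₂₄, p.x₃₄,
      p.l₂, p.l₁ + p.x₁₂ * p.l₂, p.l₃, p.l₄, p.v₂ - p.x₁₂ * p.v₁, p.v₁, p.v₃, p.v₄⟩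
  left_inv p := by ext <;> simp
  right_inv p := by ext <;> simp

/-- The braid move on the middle two basis vectors. -/
def T₂ : Equiv.Perm (Pt k) where
  toFun p :=
    ⟨p.x₁₃ + p.x₂₃ * p.x₁₂, p.x₁₂, p.x₁₄, -p.x₂₃, p.x₃₄ + p.x₂₃ * p.x₂₄, p.x₂₄,
      p.l₁, p.l₃ + p.x₂₃ * p.l₂, p.l₂, p.l₄, p.v₁, p.v₃, p.v₂ - p.x₂₃ * p.v₃, p.v₄⟩
  invFun p :=
    ⟨p.x₁₃, p.x₁₂ + p.x₂₃ * p.x₁₃, p.x₁₄, -p.x₂₃, p.x₃₄, p.x₂₄ + p.x₂₃ * p.x₃₄,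
      p.l₁, p.l₃, p.l₂ + p.x₂₃ * p.l₃, p.l₄, p.v₁, p.v₃ - p.x₂₃ * p.v₂, p.v₂, p.v₄⟩
  left_inv p := by ext <;> simp
  right_inv p := by ext <;> simp

/-- The braid move on the last two basis vectors. -/
def T₃ : Equiv.Perm (Pt k) where
  toFun p :=
    ⟨p.x₁₂, p.x₁₄ + p.x₃₄ * p.x₁₃, p.x₁₃, p.x₂₄ + p.x₃₄ * p.x₂₃, p.x₂₃, -p.x₃₄,
      p.l₁, p.l₂, p.l₄ + p.x₃₄ * p.l₃, p.l₃, p.v₁, p.v₂, p.v₄, p.v₃ - p.x₃₄ * p.v₄⟩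
  invFun p :=
    ⟨p.x₁₂, p.x₁₄, p.x₁₃ + p.x₃₄ * p.x₁₄, p.x₂₄, p.x₂₃ + p.x₃₄ * p.x₂₄, -p.x₃₄,
      p.l₁, p.l₂, p.l₄, p.l₃ + p.x₃₄ * p.l₄, p.v₁, p.v₂, p.v₄ - p.x₃₄ * p.v₃, p.v₃⟩
  left_inv p := by ext <;> simp
  right_inv p := by ext <;> simp

theorem s₁_mul_self : (s₁ : Equiv.Perm (Pt k)) * s₁ = 1 := by
  ext p <;> simp [s₁]; ring

theorem T₁_braid : (T₁ : Equiv.Perm (Pt k)) * T₂ * T₁ = T₂ * T₁ * T₂ := by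
  ext p <;> simp [T₁, T₂] <;> ring

theorem T₃_braid : (T₃ : Equiv.Perm (Pt k)) * T₂ * T₃ = T₂ * T₃ * T₂ := by
  ext p <;> simp [T₃, T₂] <;> ring

theorem T₁_T₃ : (T₁ : Equiv.Perm (Pt k)) * T₃ = T₃ * T₁ := by
  ext p <;> simp [T₁, T₃]; ring

theorem s₁_T₂ : (s₁ : Equiv.Perm (Pt k)) * T₂ = T₂ * s₁ := by
  ext p <;> simp [s₁, T₂]; ring

theorem s₁_T₃ : (s₁ : Equiv.Perm (Pt k)) * T₃ = T₃ * s₁ := by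
  ext p <;> simp [s₁, T₃]; ring

theorem T₁_s₁_T₁ : (T₁ : Equiv.Perm (Pt k)) * (s₁ * T₁ * s₁) = s₁ * T₁ * s₁ * T₁ := by
  ext p <;> simp [s₁, T₁] <;> ring

theorem T₁_s₁ : (T₁ : Equiv.Perm (Pt k)) * s₁ = s₂ * T₁ := by
  ext p <;> simp [s₁, s₂, T₁]; ring

theorem T₂_s₂ : (T₂ : Equiv.Perm (Pt k)) * s₂ = s₃ * T₂ := by
  ext p <;> simp [s₂, s₃, T₂]; ring

theorem T₃_s₃ : (T₃ : Equiv.Perm (Pt k)) * s₃ = s₄ * T₃ := by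
  ext p <;> simp [s₃, s₄, T₃]; ring

/-- The permutations by which the generators act on points. -/
def genPerm : Gen → Equiv.Perm (Pt k)
  | a => T₁
  | b => s₁ * T₁ * s₁
  | c => T₃
  | d => T₂

theorem s₁_inv : (s₁ : Equiv.Perm (Pt k))⁻¹ = s₁ := inv_eq_of_mul_eq_one_left s₁_mul_self

theorem conj_s₁_genPerm (s : Gen) :
    MulAut.conj s₁ (genPerm s : Equiv.Perm (Pt k)) = genPerm (swapGen s) := by
  cases s
  · simp [genPerm, swapGen, s₁_inv]
  · simp [genPerm, swapGen, ← mul_assoc, s₁_mul_self]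
  · simp [genPerm, swapGen, s₁_T₃]
  · simp [genPerm, swapGen, s₁_T₂]

theorem genPerm_braid (s : Gen) (hs : s ≠ d) :
    (genPerm s : Equiv.Perm (Pt k)) * genPerm d * genPerm s
      = genPerm d * genPerm s * genPerm d := by
  cases s
  · exact T₁_braid
  · have := congrArg (MulAut.conj s₁) (T₁_braid (k := k))
    simp only [map_mul] at this
    rw [show (T₁ : Equiv.Perm (Pt k)) = genPerm a from rfl,
      show (T₂ : Equiv.Perm (Pt k)) = genPerm d from rfl] at this
    simpa only [conj_s₁_genPerm, swapGen] using this
  · exact T₃_braid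
  · exact absurd rfl hs

theorem genPerm_comm (s t : Gen) (hs : s ≠ d) (ht : t ≠ d) :
    (genPerm s : Equiv.Perm (Pt k)) * genPerm t = genPerm t * genPerm s := by
  have hbc : (genPerm b : Equiv.Perm (Pt k)) * genPerm c = genPerm c * genPerm b := by
    have := congrArg (MulAut.conj s₁) (T₁_T₃ (k := k))
    simp only [map_mul] at this
    rw [show (T₁ : Equiv.Perm (Pt k)) = genPerm a from rfl,
      show (T₃ : Equiv.Perm (Pt k)) = genPerm c from rfl] at this
    simpa only [conj_s₁_genPerm, swapGen] using this
  cases s <;> cases t <;> first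
    | rfl
    | exact absurd rfl hs
    | exact absurd rfl ht
    | exact hbc
    | exact hbc.symm
    | exact T₁_T₃
    | exact T₁_T₃.symm
    | exact T₁_s₁_T₁
    | exact T₁_s₁_T₁.symm

/-- The action of the extension of the Artin group on points. -/
def act : ExtArtin →* Equiv.Perm (Pt k) :=
  SemidirectProduct.lift (lift genPerm genPerm_braid genPerm_comm)
    (unitsLift s₁ s₁_mul_self) fun u => by
    rcases Int.units_eq_one_or u with rfl | rfl
    · exact MonoidHom.ext fun g => by simp
    · refine hom_ext fun s => ?_
      simpa [-MulAut.conj_apply] using (conj_s₁_genPerm s).symm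

theorem act_gen (s : Gen) : act (incl (gen s)) = (genPerm s : Equiv.Perm (Pt k)) :=
  (SemidirectProduct.lift_inl _ _ _ _).trans (lift_gen _ _ _ _)

theorem act_invol : act invol = (s₁ : Equiv.Perm (Pt k)) :=
  (SemidirectProduct.lift_inr _ _ _ _).trans (unitsLift_neg_one _ _)

theorem act_refl₂ : act refl₂ = (s₂ : Equiv.Perm (Pt k)) := by
  rw [refl₂, map_mul, map_mul, map_inv, act_gen, act_invol]
  exact mul_inv_eq_of_eq_mul T₁_s₁

theorem act_refl₃ : act refl₃ = (s₃ : Equiv.Perm (Pt k)) := by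
  rw [refl₃, map_mul, map_mul, map_inv, act_gen, act_refl₂]
  exact mul_inv_eq_of_eq_mul T₂_s₂

theorem act_refl₄ : act refl₄ = (s₄ : Equiv.Perm (Pt k)) := by
  rw [refl₄, map_mul, map_mul, map_inv, act_gen, act_refl₃]
  exact mul_inv_eq_of_eq_mul T₃_s₃

section Equivariance

variable {k' : Type*} [CommRing k']

/-- The elements whose action is intertwined by a map. -/
def intertwiner (f : Pt k → Pt k') : Subgroup ExtArtin where
  carrier := {g | ∀ p, f (act g p) = act g (f p)}
  one_mem' p := by simp
  mul_mem' {g h} hg hh p := by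
    rw [map_mul, map_mul, Equiv.Perm.mul_apply, Equiv.Perm.mul_apply, hg, hh]
  inv_mem' {g} hg p := by
    rw [map_inv, map_inv, Equiv.Perm.eq_inv_iff_eq, ← hg]
    simp

theorem incl_mem_intertwiner {f : Pt k → Pt k'} (h₁ : ∀ p, f (T₁ p) = T₁ (f p))
    (h₂ : ∀ p, f (T₂ p) = T₂ (f p)) (h₃ : ∀ p, f (T₃ p) = T₃ (f p)) {g : Artin}
    (hg : g ∈ Ahat b) : incl g ∈ intertwiner f := by
  have : Ahat b ≤ (intertwiner f).comap incl := by
    refine (Subgroup.closure_le _).2 ?_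
    rintro _ ⟨s, hs, rfl⟩ p
    rw [act_gen, act_gen]
    cases s
    · exact h₁ p
    · exact absurd rfl hs
    · exact h₃ p
    · exact h₂ p
  exact this hg

/-- Rescaling the vector. -/
def scale (r : k) (p : Pt k) : Pt k :=
  { p with v₁ := r * p.v₁, v₂ := r * p.v₂, v₃ := r * p.v₃, v₄ := r * p.v₄ }

theorem scale_act (r : k) {g : Artin} (hg : g ∈ Ahat b) (p : Pt k) :
    scale r (act (incl g) p) = act (incl g) (scale r p) := by
  refine incl_mem_intertwiner ?_ ?_ ?_ hg p <;> intro p <;> ext <;>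
    simp [scale, T₁, T₂, T₃] <;> ring

/-- Forgetting the linear form. -/
def forget (p : Pt k) : Pt k := { p with l₁ := 0, l₂ := 0, l₃ := 0, l₄ := 0 }

theorem forget_act {g : Artin} (hg : g ∈ Ahat b) (p : Pt k) :
    forget (act (incl g) p) = act (incl g) (forget p) := by
  refine incl_mem_intertwiner ?_ ?_ ?_ hg p <;> intro p <;> ext <;>
    simp [forget, T₁, T₂, T₃]

/-- Change of coefficients. -/
def map (f : k →+* k') (p : Pt k) : Pt k' :=
  ⟨f p.x₁₂, f p.x₁₃, f p.x₁₄, f p.x₂₃, f p.x₂₄, f p.x₃₄, f p.l₁, f p.l₂, f p.l₃, f p.l₄,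
    f p.v₁, f p.v₂, f p.v₃, f p.v₄⟩

theorem map_act (f : k →+* k') {g : Artin} (hg : g ∈ Ahat b) (p : Pt k) :
    map f (act (incl g) p) = act (incl g) (map f p) := by
  refine incl_mem_intertwiner ?_ ?_ ?_ hg p <;> intro p <;> ext <;>
    simp [map, T₁, T₂, T₃]

theorem invol_mem_intertwiner (f : k →+* k') : invol ∈ intertwiner (map f) := by
  intro p
  rw [act_invol, act_invol]
  ext <;> simp [map, s₁]

end Equivariance

end Pt

/-- The four reflections, as a family. -/
def reflection : Fin 4 → ExtArtin := ![invol, refl₂, refl₃, refl₄]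

theorem reflection_mul_self (j : Fin 4) : reflection j * reflection j = 1 := by
  fin_cases j
  · exact invol_mul_invol
  · exact refl₂_mul_self
  · exact refl₃_mul_self
  · exact refl₄_mul_self

theorem reflection_mem₃ {j : Fin 4} (hj : j ≠ 3) : reflection j ∈ reflSubgroup₃ := by
  fin_cases j
  · exact invol_mem₃
  · exact refl₂_mem₃
  · exact refl₃_mem₃
  · exact absurd rfl hj

theorem reflSubgroup₄_eq_closure_range :
    reflSubgroup₄ = Subgroup.closure (Set.range reflection) := by
  simp only [reflSubgroup₄, reflection, Matrix.range_cons, Matrix.range_empty, Set.union_empty,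
    Set.singleton_union]

/-- The elements represented by a word in the reflections without repeated consecutive letters,
which begins with `j` and whose last letter lies outside `W`, followed by an element of `W`. -/
inductive Reduced (W : Subgroup ExtArtin) : Fin 4 → ExtArtin → Prop
  | base {j : Fin 4} {w : ExtArtin} (hw : w ∈ W) (hj : reflection j ∉ W) :
      Reduced W j (reflection j * w)
  | step {j k : Fin 4} {u : ExtArtin} (hu : Reduced W j u) (hkj : k ≠ j) :
      Reduced W k (reflection k * u)

theorem mem_or_exists_reduced (W : Subgroup ExtArtin) {u : ExtArtin} (hu : u ∈ reflSubgroup₄) :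
    u ∈ W ∨ ∃ j, Reduced W j u := by
  have hstep (k : Fin 4) {u : ExtArtin} (hu : u ∈ W ∨ ∃ j, Reduced W j u) :
      reflection k * u ∈ W ∨ ∃ j, Reduced W j (reflection k * u) := by
    rcases hu with hu | ⟨j, hu⟩
    · by_cases hk : reflection k ∈ W
      · exact .inl (mul_mem hk hu)
      · exact .inr ⟨k, .base hu hk⟩
    · by_cases hkj : k = j
      · subst hkj
        cases hu with
        | base hw _ => rw [← mul_assoc, reflection_mul_self, one_mul]; exact .inl hw
        | step hu _ => rw [← mul_assoc, reflection_mul_self, one_mul]; exact .inr ⟨_, hu⟩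
      · exact .inr ⟨k, .step hu hkj⟩
  rw [reflSubgroup₄_eq_closure_range] at hu
  induction hu using Subgroup.closure_induction_left with
  | one => exact .inl (one_mem W)
  | mul_left x hx y _ ih =>
    obtain ⟨k, rfl⟩ := hx
    exact hstep k ih
  | inv_mul_cancel x hx y _ ih =>
    obtain ⟨k, rfl⟩ := hx
    rw [inv_eq_of_mul_eq_one_left (reflection_mul_self k)]
    exact hstep k ih

namespace Pt

/-- The point with all off-diagonal entries equal to two. -/
def two {k : Type*} [CommRing k] (l v : Fin 4 → k) : Pt k :=
  ⟨2, 2, 2, 2, 2, 2, l 0, l 1, l 2, l 3, v 0, v 1, v 2, v 3⟩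

theorem act_reflection_two {k : Type*} [CommRing k] (j : Fin 4) (l v : Fin 4 → k) :
    act (reflection j) (two l v)
      = two l (Function.update v j (l j - 3 * v j + 2 * ∑ i, v i)) := by
  rw [Fin.sum_univ_four]
  fin_cases j
  · change act invol _ = _
    rw [act_invol]; ext <;> simp [two, s₁]; ring
  · change act refl₂ _ = _
    rw [act_refl₂]; ext <;> simp [two, s₂]; ring
  · change act refl₃ _ = _
    rw [act_refl₃]; ext <;> simp [two, s₃]; ring
  · change act refl₄ _ = _
    rw [act_refl₄]; ext <;> simp [two, s₄]; ring

variable {W : Subgroup ExtArtin} {l : Fin 4 → ℤ}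

/-- A reduced word beginning with `j` moves the origin to a vector whose `j`-th coordinate is
positive and maximal. -/
theorem exists_act_reduced (hW : ∀ w ∈ W, act w (two l 0) = two l 0) (hl : 0 ≤ l)
    (hlW : ∀ j, reflection j ∉ W → 0 < l j) {j : Fin 4} {u : ExtArtin} (hu : Reduced W j u) :
    ∃ v : Fin 4 → ℤ, act u (two l 0) = two l v ∧ 0 < v j ∧ ∀ i, 0 ≤ v i ∧ v i ≤ v j := by
  induction hu with
  | @base j w hw hj =>
    refine ⟨Function.update 0 j (l j), ?_, ?_, fun i => ?_⟩
    · rw [map_mul, Equiv.Perm.mul_apply, hW w hw, act_reflection_two]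
      simp
    · simpa using hlW j hj
    · have := hlW j hj
      by_cases hij : i = j
      · subst hij; simpa using this.le
      · simpa [hij] using this.le
  | @step j k u _ hkj ih =>
    obtain ⟨v, hv, hpos, hmax⟩ := ih
    have hlk : 0 ≤ l k := hl k
    have hsum : v k + v j ≤ ∑ i, v i := by
      rw [← Finset.sum_pair hkj]
      exact Finset.sum_le_sum_of_subset_of_nonneg (Finset.subset_univ _)
        fun i _ _ => (hmax i).1
    have hk := hmax k
    refine ⟨_, by rw [map_mul, Equiv.Perm.mul_apply, hv, act_reflection_two], ?_, fun i => ?_⟩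
    · rw [Function.update_self]; linarith
    · rw [Function.update_self]
      by_cases hik : i = k
      · subst hik
        rw [Function.update_self]
        exact ⟨by linarith, le_rfl⟩
      · rw [Function.update_of_ne hik]
        exact ⟨(hmax i).1, by linarith [(hmax i).2]⟩

theorem mem₃_of_v₄_eq_zero {u : ExtArtin} (hu : u ∈ reflSubgroup₄)
    (h : (act u (two (1 : Fin 4 → ℤ) 0)).v₄ = 0) : u ∈ reflSubgroup₃ := by
  have hdom {j : Fin 4} {u : ExtArtin} (hu : Reduced ⊥ j u) :=
    exists_act_reduced (l := 1) (by simp) zero_le_one (fun _ _ => zero_lt_one) hu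
  have key {j : Fin 4} {u : ExtArtin} (hu : Reduced ⊥ j u) :
      u ∈ reflSubgroup₃ ∨ 0 < (act u (two (1 : Fin 4 → ℤ) 0)).v₄ := by
    induction hu with
    | @base j w hw hj =>
      by_cases h3 : j = 3
      · subst h3
        obtain ⟨v, hv, hpos, -⟩ := hdom (.base hw hj)
        exact .inr (hv ▸ hpos)
      · rw [Subgroup.mem_bot.1 hw, mul_one]
        exact .inl (reflection_mem₃ h3)
    | @step j k u hu hkj ih =>
      by_cases h3 : k = 3
      · subst h3
        obtain ⟨v, hv, hpos, -⟩ := hdom (.step hu hkj)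
        exact .inr (hv ▸ hpos)
      · refine ih.imp (mul_mem (reflection_mem₃ h3)) fun ih => ?_
        obtain ⟨v, hv, -⟩ := hdom hu
        rw [hv] at ih
        rw [map_mul, Equiv.Perm.mul_apply, hv, act_reflection_two]
        change 0 < Function.update v k _ 3
        rwa [Function.update_of_ne (Ne.symm h3)]
  rcases mem_or_exists_reduced ⊥ hu with hu | ⟨j, hu⟩
  · rw [Subgroup.mem_bot.1 hu]; exact one_mem _
  · exact (key hu).resolve_right h.not_gt

theorem act_eq_self_of_mem₃ {k : Type*} [CommRing k] {p : Pt k} (hl₁ : p.l₁ = 0) (hl₂ : p.l₂ = 0)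
    (hl₃ : p.l₃ = 0) (hv₁ : p.v₁ = 0) (hv₂ : p.v₂ = 0) (hv₃ : p.v₃ = 0) (hv₄ : p.v₄ = 0)
    {u : ExtArtin} (hu : u ∈ reflSubgroup₃) : act u p = p := by
  induction hu using Subgroup.closure_induction with
  | mem x hx =>
    rcases hx with rfl | rfl | rfl
    · rw [act_invol]; ext <;> simp [s₁, *]
    · rw [act_refl₂]; ext <;> simp [s₂, *]
    · rw [act_refl₃]; ext <;> simp [s₃, *]
  | one => simp
  | mul x y _ _ hx hy => rw [map_mul, Equiv.Perm.mul_apply, hy, hx]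
  | inv x _ hx => rw [map_inv, Equiv.Perm.inv_eq_iff_eq, hx]

theorem mem₃_of_act_eq_self {u : ExtArtin} (hu : u ∈ reflSubgroup₄)
    (h : act u (two (Pi.single 3 1 : Fin 4 → ℤ) 0) = two (Pi.single 3 1) 0) :
    u ∈ reflSubgroup₃ := by
  have hl (i : Fin 4) (hi : reflection i ∉ reflSubgroup₃) : 0 < (Pi.single 3 1 : Fin 4 → ℤ) i := by
    obtain rfl : i = 3 := by
      by_contra h3
      exact hi (reflection_mem₃ h3)
    simp
  refine (mem_or_exists_reduced _ hu).resolve_right ?_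
  rintro ⟨j, hj⟩
  obtain ⟨v, hv, hpos, -⟩ := exists_act_reduced (l := Pi.single 3 1)
    (fun _ hw => act_eq_self_of_mem₃ rfl rfl rfl rfl rfl rfl rfl hw)
    (Pi.single_nonneg.2 zero_le_one) hl hj
  rw [hv] at h
  have h0 : v = 0 := by
    simp only [two, Pt.mk.injEq] at h
    ext i
    fin_cases i <;> simp_all
  simp [h0] at hpos

/-- The reflections `1`, `2`, `3` do not change the fourth coordinate. -/
theorem act_v₄_of_mem₃ {k : Type*} [CommRing k] {u : ExtArtin} (hu : u ∈ reflSubgroup₃) (p : Pt k) :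
    (act u p).v₄ = p.v₄ := by
  induction hu using Subgroup.closure_induction generalizing p with
  | mem x hx =>
    rcases hx with rfl | rfl | rfl
    · rw [act_invol]; rfl
    · rw [act_refl₂]; rfl
    · rw [act_refl₃]; rfl
  | one => simp
  | mul x y _ _ hx hy => rw [map_mul, Equiv.Perm.mul_apply, hx, hy]
  | inv x _ hx => rw [← hx, ← Equiv.Perm.mul_apply, ← map_mul, mul_inv_cancel]; simp

end Pt

namespace Pt

section Conjugation

variable {k : Type*} [CommRing k]

/-- Replacing the first coordinate of the vector by one. -/
def unitV (p : Pt k) : Pt k := { p with v₁ := 1 }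

theorem scale_zero_act {g : Artin} (hg : g ∈ Ahat b) {p : Pt k} (hp : scale 0 p = p) :
    scale 0 (act (incl g) p) = act (incl g) p := by
  rw [scale_act 0 hg, hp]

theorem s₁_of_scale_zero {p : Pt k} (hp : scale 0 p = p) : s₁ p = scale p.l₁ (unitV p) := by
  rw [← hp]
  ext <;> simp [scale, unitV, s₁]

theorem act_conj_invol {g : Artin} (hg : g ∈ Ahat b) {p : Pt k} (hp : scale 0 p = p) :
    act (incl g * invol * (incl g)⁻¹) p
      = scale (act (incl g⁻¹) p).l₁ (act (incl g) (unitV (act (incl g⁻¹) p))) := by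
  rw [scale_act _ hg, ← s₁_of_scale_zero (scale_zero_act (inv_mem hg) hp), ← map_inv, map_mul,
    map_mul, act_invol]
  rfl

theorem act_v₄_congr {g : Artin} (hg : g ∈ Ahat b) {p q : Pt k} (h : forget p = forget q) :
    (act (incl g) p).v₄ = (act (incl g) q).v₄ := by
  have := congrArg v₄ (congrArg (act (incl g)) h)
  rwa [← forget_act hg, ← forget_act hg] at this

theorem forget_act_congr {g : Artin} (hg : g ∈ Ahat b) {p q : Pt k} (h : forget p = forget q) :
    forget (act (incl g) p) = forget (act (incl g) q) := by
  rw [forget_act hg, forget_act hg, h]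

theorem forget_unitV (p : Pt k) : forget (unitV p) = unitV (forget p) := rfl

end Conjugation

/-- The point with independent off-diagonal entries, the fourth coordinate form, and the zero
vector. -/
noncomputable def generic : Pt (MvPolynomial (Fin 6) ℤ) :=
  ⟨.X 0, .X 1, .X 2, .X 3, .X 4, .X 5, 0, 0, 0, 1, 0, 0, 0, 0⟩

theorem scale_zero_generic : scale 0 generic = generic := by
  ext1 <;> simp [scale, generic]

theorem map_unitV {k k' : Type*} [CommRing k] [CommRing k'] (f : k →+* k') (p : Pt k) :
    map f (unitV p) = unitV (map f p) := by
  ext <;> simp [map, unitV]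

/-- Generic off-diagonal entries specialize to arbitrary ones. -/
theorem exists_forget_map_generic {q : Pt ℤ} (hq : scale 0 q = q) :
    ∃ f : MvPolynomial (Fin 6) ℤ →+* ℤ, forget (map f generic) = forget q := by
  refine ⟨MvPolynomial.eval ![q.x₁₂, q.x₁₃, q.x₁₄, q.x₂₃, q.x₂₄, q.x₃₄], ?_⟩
  rw [← hq]
  ext <;> simp [forget, map, scale, generic]

theorem map_generic_eq_two :
    map (MvPolynomial.eval fun _ => 2) generic = two (Pi.single 3 1 : Fin 4 → ℤ) 0 := by
  ext <;> simp [map, two, generic]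

/-- If a conjugate of the involution fixes the fourth coordinate of a translate of the generic
point, it lies in `reflSubgroup₃`, or its conjugate fixes the generic point. -/
theorem mem₃_or_act_generic {p g : Artin} (hp : p ∈ Ahat b) (hg : g ∈ Ahat b)
    (h : (act (incl p * invol * (incl p)⁻¹) (act (incl g) generic)).v₄ = 0) :
    incl p * invol * (incl p)⁻¹ ∈ reflSubgroup₃ ∨
      act (incl p * invol * (incl p)⁻¹) (act (incl g) generic) = act (incl g) generic := by
  have hq := scale_zero_act hg scale_zero_generic
  rw [act_conj_invol hp hq] at h
  rcases mul_eq_zero.1 h with h | h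
  · right
    rw [act_conj_invol hp hq, h, scale_act 0 hp]
    have h1 := s₁_of_scale_zero (scale_zero_act (inv_mem hp) hq)
    rw [h] at h1
    have h2 : scale 0 (unitV (act (incl p⁻¹) (act (incl g) generic)))
        = scale 0 (act (incl p⁻¹) (act (incl g) generic)) := by
      ext1 <;> simp [scale, unitV]
    rw [h2, scale_zero_act (inv_mem hp) hq, ← Equiv.Perm.mul_apply, ← map_mul, ← map_mul]
    simp
  · left
    have ho : scale 0 (two (1 : Fin 4 → ℤ) 0) = two 1 0 := by ext <;> simp [scale, two]
    obtain ⟨f, hf⟩ := exists_forget_map_generic (scale_zero_act (inv_mem hg) ho)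
    refine mem₃_of_v₄_eq_zero (incl_conj_mem₄ hp (reflSubgroup₃_le invol_mem₃)) ?_
    rw [act_conj_invol hp ho]
    have hf' := forget_act_congr (inv_mem hp) (forget_act_congr hg hf)
    rw [← Equiv.Perm.mul_apply (act (incl g)), ← map_mul, ← map_mul, mul_inv_cancel, map_one,
      map_one, Equiv.Perm.one_apply, ← map_act f hg, ← map_act f (inv_mem hp)] at hf'
    refine mul_eq_zero_of_right _ ?_
    rw [act_v₄_congr hp (q := map f (unitV (act (incl p⁻¹) (act (incl g) generic))))
      (by rw [map_unitV, forget_unitV, forget_unitV, hf']), ← map_act f hp]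
    change f _ = 0
    rw [h, map_zero]

theorem mem₃_of_act_generic {p g : Artin} (hp : p ∈ Ahat b) (hg : g ∈ Ahat b)
    (h : act (incl p * invol * (incl p)⁻¹) (act (incl g) generic) = act (incl g) generic) :
    (incl g)⁻¹ * (incl p * invol * (incl p)⁻¹) * incl g ∈ reflSubgroup₃ := by
  have hmem : (incl g)⁻¹ * (incl p * invol * (incl p)⁻¹) * incl g ∈ reflSubgroup₄ := by
    simpa using incl_conj_mem₄ (inv_mem hg) (incl_conj_mem₄ hp (reflSubgroup₃_le invol_mem₃))
  refine mem₃_of_act_eq_self hmem ?_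
  have hmap {x : Artin} (hx : x ∈ Ahat b) :
      incl x ∈ intertwiner (map (MvPolynomial.eval fun _ : Fin 6 => (2 : ℤ))) := map_act _ hx
  have := mul_mem (mul_mem (inv_mem (hmap hg)) (mul_mem (mul_mem (hmap hp)
    (invol_mem_intertwiner _)) (inv_mem (hmap hp)))) (hmap hg) generic
  rw [← map_generic_eq_two, ← this, map_mul _ _ (incl g), Equiv.Perm.mul_apply, map_mul,
    Equiv.Perm.mul_apply, h, ← Equiv.Perm.mul_apply, ← map_mul, inv_mul_cancel, map_one,
    Equiv.Perm.one_apply]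

end Pt

/-- A conjugate of the involution that factors through `reflSubgroup₃` and a conjugate of it lies
in one of the two. -/
theorem conj_invol_mem₃_or {p g : Artin} (hp : p ∈ Ahat b) (hg : g ∈ Ahat b) {h h' : ExtArtin}
    (hh : h ∈ reflSubgroup₃) (hh' : h' ∈ reflSubgroup₃)
    (he : incl p * invol * (incl p)⁻¹ = h * (incl g * h' * (incl g)⁻¹)) :
    incl p * invol * (incl p)⁻¹ ∈ reflSubgroup₃ ∨
      (incl g)⁻¹ * (incl p * invol * (incl p)⁻¹) * incl g ∈ reflSubgroup₃ := by
  refine (Pt.mem₃_or_act_generic hp hg ?_).imp_right (Pt.mem₃_of_act_generic hp hg)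
  rw [he, ← Equiv.Perm.mul_apply, ← map_mul, mul_assoc, inv_mul_cancel_right, map_mul,
    Equiv.Perm.mul_apply, Pt.act_v₄_of_mem₃ hh, map_mul, Equiv.Perm.mul_apply,
    Pt.act_eq_self_of_mem₃ rfl rfl rfl rfl rfl rfl rfl hh',
    ← Pt.scale_zero_act hg Pt.scale_zero_generic]
  exact zero_mul _

theorem incl_of_swapHom (g : Artin) : incl g = invol * incl (swapHom g) * invol := by
  rw [← incl_swapHom, swapHom_swapHom]

/-- A closed path of length five between cosets of the three parabolic subgroups degenerates. -/
theorem exists_shortcut {p α γ γ' β : Artin} (hp : p ∈ Ahat b) (hα : α ∈ Ahat a)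
    (hγ : γ ∈ Ahat c) (hγ' : γ' ∈ Ahat c) (hβ : β ∈ Ahat b) (he : p * α * γ = γ' * β) :
    (∃ δ ∈ Ahat a, p * δ ∈ Ahat c) ∨ ∃ δ ∈ Ahat c, p * α * δ ∈ Ahat b := by
  have hα' : swapHom α ∈ Ahat b := swapHom_mem_Ahat (s := a) hα
  obtain ⟨h, hh, k, hk, hhk⟩ := exists_factorization hγ
  obtain ⟨h', hh', k', hk', hhk'⟩ := exists_factorization hγ'
  have hg : p * swapHom α ∈ Ahat b := mul_mem hp hα'
  set g := p * swapHom α with hgdef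
  set y := incl p * invol * (incl p)⁻¹ with hy
  have hpα : incl (p * α) = y * incl g * invol := by
    rw [map_mul, incl_of_swapHom α, hgdef, hy, map_mul]
    simp only [mul_assoc, inv_mul_cancel_left]
  have hth : invol * h ∈ reflSubgroup₃ := mul_mem invol_mem₃ hh
  have hprod : y * (incl g * (invol * h) * (incl g)⁻¹) * incl (g * k) = h' * incl (k' * β) := by
    have := congrArg incl he
    rw [map_mul, hpα, map_mul incl γ', hhk, hhk'] at this
    simp only [map_mul incl g, map_mul incl k', mul_assoc, inv_mul_cancel_left] at this ⊢
    exact this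
  have hy₄ : y ∈ reflSubgroup₄ := incl_conj_mem₄ hp (reflSubgroup₃_le invol_mem₃)
  have hinj := mul_incl_inj (mul_mem hy₄ (incl_conj_mem₄ hg (reflSubgroup₃_le hth)))
    (reflSubgroup₃_le hh') (mul_mem hg hk) (mul_mem hk' hβ) hprod
  refine (conj_invol_mem₃_or hp hg hh' (inv_mem hth) ?_).imp (fun h₁ => ?_) fun h₁ => ?_
  · rw [← hinj, ← hy]
    clear_value y
    group
  · refine ⟨(swapHom p)⁻¹, inv_mem (swapHom_mem_Ahat (s := b) hp), ?_⟩
    rw [← incl_mem_extAhat, map_mul, map_inv, incl_swapHom]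
    have := mul_mem (reflSubgroup₃_le_extAhat h₁) invol_mem_extAhat
    simpa [mul_assoc] using this
  · refine ⟨(g⁻¹ * (p * α))⁻¹, inv_mem ?_, by simpa [mul_assoc] using hg⟩
    rw [← incl_mem_extAhat, map_mul, map_inv, hpα]
    have := mul_mem (reflSubgroup₃_le_extAhat h₁) invol_mem_extAhat
    simpa [mul_assoc, y] using this

theorem IsCosetOf.mem_iff {X : Set Artin} {H : Subgroup Artin} (hX : IsCosetOf X H) {x y : Artin}
    (hx : x ∈ X) : y ∈ X ↔ x⁻¹ * y ∈ H := by
  obtain ⟨g, rfl⟩ := hX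
  rw [mem_leftCoset_iff, SetLike.mem_coe] at hx ⊢
  rw [← Subgroup.mul_mem_cancel_left H (inv_mem hx)]
  simp [mul_assoc]

end D4Artin

open D4Artin D4Artin.Gen

/-- If for a type II 6-cycle `(x 0, …, x 5)` in the `D₄` Artin complex there is a left coset of
`A_b̂` meeting each of `x 0`, `x 5`, `x 4`, `x 3`, then the cycle satisfies property `(*)`. -/
theorem typeII_property_star_of_bhat_coset (x : Fin 6 → Set Artin) (hx : TypeII x)
    (hz : ∃ z : Set Artin, IsCosetOf z (Ahat b) ∧
      (z ∩ x 0).Nonempty ∧ (z ∩ x 5).Nonempty ∧ (z ∩ x 4).Nonempty ∧ (z ∩ x 3).Nonempty) :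
    Star x := by
  obtain ⟨h0, -, h2, h1, h3, -, -, -, -, -, hne⟩ := hx
  obtain ⟨z, hz, ⟨e₁, h1z, h10⟩, hz5, -, ⟨e₅, h5z, h53⟩⟩ := hz
  obtain ⟨e₂, h20, h21⟩ := hne 0
  obtain ⟨e₃, h31, h32⟩ := hne 1
  obtain ⟨e₄, h42, h43⟩ := hne 2
  obtain ⟨e₆, h65, h60⟩ := hne 5
  rcases exists_shortcut ((hz.mem_iff h5z).1 h1z) ((h0.mem_iff h10).1 h20)
    ((h1.mem_iff h21).1 h31) ((h3.mem_iff h53).1 h43) ((h2.mem_iff h42).1 h32)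
    (by group) with ⟨δ, hδ, hc⟩ | ⟨δ, hδ, hb⟩
  · refine ⟨x 0, .inl h0, ⟨e₂, h20, h21⟩, ⟨e₁ * δ, ?_, ?_⟩, ⟨e₆, h60, h65⟩⟩
    · rwa [h0.mem_iff h10, inv_mul_cancel_left]
    · rwa [h3.mem_iff h53, ← mul_assoc]
  · refine ⟨z, .inr hz, ⟨e₂ * δ, ?_, ?_⟩, ⟨e₅, h5z, h53⟩, hz5⟩
    · rw [hz.mem_iff h5z]
      simpa [mul_assoc] using hb
    · rwa [h1.mem_iff h21, inv_mul_cancel_left]
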